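/- arXiv:2405.05644 — 7 statements merged into one kernel-verified Lean document; each statement's English description precedes it below -/
import Mathlib

section
/- Suppose XᵀX is a diagonal matrix with strictly positive diagonal entries x₁₁, …, x_pp, and suppose α equals the OLS estimator β̂ = (XᵀX)⁻¹·Xᵀy. Then for every k ≥ 0 and every index i, the i-th component of the penalized estimator satisfies β̂(k,h)ᵢ = ((xᵢᵢ + k·h)/(xᵢᵢ + k)) · β̂ᵢ. -/
open Matrix

/-- The inverse of an invertible diagonal matrix acts on vectors by componentwise division. -/
theorem Matrix.inv_diagonal_mulVec_apply {ι K : Type*} [Fintype ι] [DecidableEq ι] [Field K]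
    {d : ι → K} (hd : ∀ i, d i ≠ 0) (v : ι → K) (i : ι) :
    ((diagonal d)⁻¹ *ᵥ v) i = v i / d i := by
  have hinv : (diagonal d)⁻¹ = diagonal fun i => (d i)⁻¹ := by
    refine inv_eq_right_inv ?_
    simp [diagonal_mul_diagonal, hd]
  rw [hinv, mulVec_diagonal, div_eq_inv_mul]

/-- If `XᵀX` is diagonal with strictly positive diagonal entries and `α` equals
the OLS estimator `β̂ = (XᵀX)⁻¹·Xᵀy`, then for every `k ≥ 0` and every index `i`,
the `i`-th component of the penalized estimator satisfies
`β̂(k,h)ᵢ = ((xᵢᵢ + k·h)/(xᵢᵢ + k)) · β̂ᵢ`. -/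
theorem penalized_orthogonal_componentwise {n p : ℕ}
    (X : Matrix (Fin n) (Fin p) ℝ) (y : Fin n → ℝ) (α : Fin p → ℝ)
    (h k : ℝ)
    (hdiag : ∀ i j, i ≠ j → (Xᵀ * X) i j = 0)
    (hpos : ∀ i, 0 < (Xᵀ * X) i i)
    (hα : α = (Xᵀ * X)⁻¹ *ᵥ (Xᵀ *ᵥ y))
    (hk : 0 ≤ k) :
    ∀ i, ((Xᵀ * X + k • (1 : Matrix (Fin p) (Fin p) ℝ))⁻¹ *ᵥ (Xᵀ *ᵥ y + (k * h) • α)) i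
      = (((Xᵀ * X) i i + k * h) / ((Xᵀ * X) i i + k)) * (((Xᵀ * X)⁻¹ *ᵥ (Xᵀ *ᵥ y)) i) := by
  intro i
  obtain ⟨d, hd⟩ : ∃ d, Xᵀ * X = diagonal d :=
    ⟨_, ((isDiag_iff_diagonal_diag _).mp fun i j hij => hdiag i j hij).symm⟩
  simp only [hd, diagonal_apply_eq] at hpos hα ⊢
  have hd_ne : ∀ j, d j ≠ 0 := fun j => (hpos j).ne'
  have hdk_ne : ∀ j, d j + k ≠ 0 := fun j => (add_pos_of_pos_of_nonneg (hpos j) hk).ne'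
  have hshift : diagonal d + k • (1 : Matrix (Fin p) (Fin p) ℝ) = diagonal fun j => d j + k := by
    rw [smul_one_eq_diagonal, diagonal_add]
  rw [hshift, inv_diagonal_mulVec_apply hdk_ne, hα, Pi.add_apply, Pi.smul_apply, smul_eq_mul,
    inv_diagonal_mulVec_apply hd_ne]
  field_simp [hd_ne i, hdk_ne i]
end

section
/- If XᵀX is positive definite and k > 0, then the matrix (XᵀX)⁻¹ − Z(k)·XᵀX·Z(k) is positive definite. Hence for every σ² > 0, the variance–covariance matrix σ²·Z(k)·XᵀX·Z(k) of the penalized estimator is strictly smaller (in the positive-definite ordering) than the OLS variance–covariance matrix σ²·(XᵀX)⁻¹. -/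
open Matrix

/-- With `Z = (A + k • 1)⁻¹`, the difference `A⁻¹ - Z * A * Z` is the congruence by `Z` of
`(2 * k) • 1 + k ^ 2 • A⁻¹`. -/
theorem Matrix.inv_sub_inv_add_smul_one_mul_mul {m R : Type*} [Fintype m] [DecidableEq m]
    [CommRing R] {A : Matrix m m R} {k : R} (hA : IsUnit A.det)
    (hM : IsUnit (A + k • (1 : Matrix m m R)).det) :
    A⁻¹ - (A + k • (1 : Matrix m m R))⁻¹ * A * (A + k • (1 : Matrix m m R))⁻¹ =
      (A + k • (1 : Matrix m m R))⁻¹ * ((2 * k) • (1 : Matrix m m R) + k ^ 2 • A⁻¹) *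
        (A + k • (1 : Matrix m m R))⁻¹ := by
  have h : (2 * k) • (1 : Matrix m m R) + k ^ 2 • A⁻¹ =
      (A + k • (1 : Matrix m m R)) * A⁻¹ * (A + k • (1 : Matrix m m R)) - A := by
    simp only [add_mul, mul_add, mul_nonsing_inv A hA, nonsing_inv_mul A hA, smul_mul_assoc,
      mul_smul_comm, one_mul, mul_one]
    module
  rw [h, mul_sub, sub_mul, mul_assoc _ A⁻¹, nonsing_inv_mul_cancel_left _ _ hM,
    mul_nonsing_inv_cancel_right _ _ hM]

/-- If `A` is positive definite and `k > 0`, then `A⁻¹ - Z * A * Z` is positive definite, where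
`Z = (A + k • 1)⁻¹`. -/
theorem Matrix.PosDef.inv_sub_inv_add_smul_one_mul_mul {m : Type*} [Fintype m] [DecidableEq m]
    {A : Matrix m m ℝ} {k : ℝ} (hA : A.PosDef) (hk : 0 < k) :
    (A⁻¹ - (A + k • (1 : Matrix m m ℝ))⁻¹ * A * (A + k • (1 : Matrix m m ℝ))⁻¹).PosDef := by
  have hM : (A + k • (1 : Matrix m m ℝ)).PosDef := hA.add (PosDef.one.smul hk)
  have hB : ((2 * k) • (1 : Matrix m m ℝ) + k ^ 2 • A⁻¹).PosDef :=
    (PosDef.one.smul (by positivity)).add (hA.inv.smul (by positivity))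
  rw [Matrix.inv_sub_inv_add_smul_one_mul_mul ((isUnit_iff_isUnit_det _).1 hA.isUnit)
    ((isUnit_iff_isUnit_det _).1 hM.isUnit)]
  have h := (IsUnit.posDef_star_left_conjugate_iff hM.inv.isUnit).2 hB
  rwa [star_eq_conjTranspose, hM.inv.isHermitian.eq] at h

/-- If `XᵀX` is positive definite and `k > 0`, then `(XᵀX)⁻¹ − Z(k)·XᵀX·Z(k)` is
positive definite, where `Z(k) = (XᵀX + k·I)⁻¹`.  Hence for every `σ² > 0` the
variance–covariance matrix `σ²·Z(k)·XᵀX·Z(k)` of the penalized estimator is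
strictly smaller, in the positive-definite ordering, than the OLS
variance–covariance matrix `σ²·(XᵀX)⁻¹`. -/
theorem penalized_variance_lt_ols {n p : ℕ}
    (X : Matrix (Fin n) (Fin p) ℝ) (k : ℝ)
    (hX : (Xᵀ * X).PosDef) (hk : 0 < k) :
    ((Xᵀ * X)⁻¹
      - (Xᵀ * X + k • (1 : Matrix (Fin p) (Fin p) ℝ))⁻¹ * (Xᵀ * X)
          * (Xᵀ * X + k • (1 : Matrix (Fin p) (Fin p) ℝ))⁻¹).PosDef ∧
    ∀ σ2 : ℝ, 0 < σ2 →
      (σ2 • (Xᵀ * X)⁻¹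
        - σ2 • ((Xᵀ * X + k • (1 : Matrix (Fin p) (Fin p) ℝ))⁻¹ * (Xᵀ * X)
            * (Xᵀ * X + k • (1 : Matrix (Fin p) (Fin p) ℝ))⁻¹)).PosDef := by
  have h := hX.inv_sub_inv_add_smul_one_mul_mul hk
  refine ⟨h, fun σ2 hσ2 => ?_⟩
  rw [← smul_sub]
  exact h.smul hσ2
end

section
/- The mean squared error of the penalized estimator has a horizontal asymptote: the function k ↦ σ²·trace(Z(k)·XᵀX·Z(k)) + ‖(Z(k)·XᵀX − I)·β + k·h·Z(k)·α‖², defined for k > 0, tends to ‖β − h·α‖² = βᵀβ − 2·h·βᵀα + h²·αᵀα as k → ∞. -/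
open Matrix Filter

/-- The normalized resolvent `k • (A + k • 1)⁻¹` tends to the identity as `k → ∞`. -/
theorem tendsto_smul_inv_add_smul_one {m : Type*} [Fintype m] [DecidableEq m]
    (A : Matrix m m ℝ) :
    Tendsto (fun k : ℝ => k • (A + k • (1 : Matrix m m ℝ))⁻¹) atTop (nhds 1) := by
  have hB : Tendsto (fun k : ℝ => k⁻¹ • A + 1) atTop (nhds 1) := by
    simpa using ((tendsto_inv_atTop_zero (𝕜 := ℝ)).smul_const A).add_const 1
  have hdet : Tendsto (fun k : ℝ => (k⁻¹ • A + 1).det) atTop (nhds 1) := by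
    simpa [Function.comp_def] using
      (continuous_id.matrix_det.tendsto (1 : Matrix m m ℝ)).comp hB
  have hinv : Tendsto (fun k : ℝ => (k⁻¹ • A + 1)⁻¹) atTop (nhds 1) := by
    have hcont : ContinuousAt Inv.inv (1 : Matrix m m ℝ) :=
      continuousAt_matrix_inv 1 (by simp)
    simpa [Function.comp_def] using hcont.tendsto.comp hB
  refine hinv.congr' ?_
  filter_upwards [eventually_gt_atTop 0, hdet.eventually_ne one_ne_zero] with k hk hd
  have hA : A + k • (1 : Matrix m m ℝ) = k • (k⁻¹ • A + 1) := by
    rw [smul_add, smul_inv_smul₀ hk.ne']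
  have := invertibleOfNonzero hk.ne'
  rw [hA, Matrix.inv_smul _ k hd.isUnit, invOf_eq_inv, smul_inv_smul₀ hk.ne']

/-- The resolvent `(A + k • 1)⁻¹` tends to zero as `k → ∞`. -/
theorem tendsto_inv_add_smul_one {m : Type*} [Fintype m] [DecidableEq m]
    (A : Matrix m m ℝ) :
    Tendsto (fun k : ℝ => (A + k • (1 : Matrix m m ℝ))⁻¹) atTop (nhds 0) := by
  have hlim := (tendsto_inv_atTop_zero (𝕜 := ℝ)).smul (tendsto_smul_inv_add_smul_one A)
  rw [zero_smul] at hlim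
  refine hlim.congr' ?_
  filter_upwards [eventually_ne_atTop 0] with k hk
  exact inv_smul_smul₀ hk _

/-- The MSE of the penalized estimator has a horizontal asymptote: with
`Z(k) = (XᵀX + k·I)⁻¹`, the function
`k ↦ σ²·trace(Z(k)·XᵀX·Z(k)) + ‖(Z(k)·XᵀX − I)·β + k·h·Z(k)·α‖²`
tends to `‖β − h·α‖² = βᵀβ − 2·h·βᵀα + h²·αᵀα` as `k → ∞`. -/
theorem penalized_mse_tendsto {n p : ℕ}
    (X : Matrix (Fin n) (Fin p) ℝ) (β α : Fin p → ℝ) (h σ2 : ℝ) :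
    Tendsto (fun k : ℝ =>
        σ2 * Matrix.trace ((Xᵀ * X + k • (1 : Matrix (Fin p) (Fin p) ℝ))⁻¹ * (Xᵀ * X)
              * (Xᵀ * X + k • (1 : Matrix (Fin p) (Fin p) ℝ))⁻¹)
          + (((Xᵀ * X + k • (1 : Matrix (Fin p) (Fin p) ℝ))⁻¹ * (Xᵀ * X) - 1) *ᵥ β
                + (k * h) • ((Xᵀ * X + k • (1 : Matrix (Fin p) (Fin p) ℝ))⁻¹ *ᵥ α)) ⬝ᵥ
              (((Xᵀ * X + k • (1 : Matrix (Fin p) (Fin p) ℝ))⁻¹ * (Xᵀ * X) - 1) *ᵥ β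
                + (k * h) • ((Xᵀ * X + k • (1 : Matrix (Fin p) (Fin p) ℝ))⁻¹ *ᵥ α)))
      atTop (nhds ((β - h • α) ⬝ᵥ (β - h • α))) ∧
    (β - h • α) ⬝ᵥ (β - h • α)
      = β ⬝ᵥ β - 2 * h * (β ⬝ᵥ α) + h ^ 2 * (α ⬝ᵥ α) := by
  constructor
  · have hZ := tendsto_inv_add_smul_one (Xᵀ * X)
    have hkZ := tendsto_smul_inv_add_smul_one (Xᵀ * X)
    let F : Matrix (Fin p) (Fin p) ℝ × Matrix (Fin p) (Fin p) ℝ → ℝ := fun M =>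
      σ2 * (M.1 * (Xᵀ * X) * M.1).trace
        + ((M.1 * (Xᵀ * X) - 1) *ᵥ β + h • (M.2 *ᵥ α)) ⬝ᵥ
          ((M.1 * (Xᵀ * X) - 1) *ᵥ β + h • (M.2 *ᵥ α))
    have hF : Continuous F := by fun_prop
    have hF_lim : F (0, 1) = (β - h • α) ⬝ᵥ (β - h • α) := by
      have hneg : -β + h • α = -(β - h • α) := by abel
      simp only [F, zero_mul, Matrix.trace_zero, mul_zero, zero_add, zero_sub,
        Matrix.neg_mulVec, Matrix.one_mulVec, hneg, neg_dotProduct_neg]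
    rw [← hF_lim]
    refine ((hF.tendsto (0, 1)).comp (hZ.prodMk_nhds hkZ)).congr fun k => ?_
    simp only [F, Function.comp_apply, Matrix.smul_mulVec, smul_smul, mul_comm h k]
  · simp only [sub_dotProduct, dotProduct_sub, smul_dotProduct, dotProduct_smul, smul_eq_mul,
      dotProduct_comm α β]
    ring
end

section
/- The second term of S(k,h) is nondecreasing in the penalty parameter: for every α ∈ ℝᵖ, the function k ↦ k²·αᵀ·(XᵀX + k·I)⁻¹·(XᵀX + k·I)⁻¹·α = k²·‖(XᵀX + k·I)⁻¹·α‖² is monotone nondecreasing on (0,∞). -/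
open Matrix

/-- If `x` and `y` solve the systems with penalties `k ≤ l` for a positive semidefinite matrix `A`
and the same right-hand side, then `‖k x‖² ≤ ‖l y‖²`. -/
theorem Matrix.PosSemidef.sq_mul_dotProduct_le {ι : Type*} [Fintype ι] {A : Matrix ι ι ℝ}
    (hA : A.PosSemidef) {k l : ℝ} (hk : 0 < k) (hkl : k ≤ l) {x y : ι → ℝ}
    (hxy : A *ᵥ x + k • x = A *ᵥ y + l • y) :
    k ^ 2 * (x ⬝ᵥ x) ≤ l ^ 2 * (y ⬝ᵥ y) := by
  have hAd : A *ᵥ (x - y) = l • y - k • x := by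
    rw [mulVec_sub, sub_eq_sub_iff_add_eq_add, hxy, add_comm]
  have hw : 0 ≤ (x - y) ⬝ᵥ (l • y - k • x) := by
    simpa [hAd] using hA.dotProduct_mulVec_nonneg (x - y)
  have hd : 0 ≤ (l • y - k • x) ⬝ᵥ (l • y - k • x) := by
    simpa using dotProduct_star_self_nonneg (l • y - k • x)
  rcases hkl.eq_or_lt with rfl | hlt
  · have hww : (x - y) ⬝ᵥ (x - y) ≤ 0 := by
      rw [← smul_sub, ← neg_sub x y, smul_neg, dotProduct_neg, dotProduct_smul, smul_eq_mul] at hw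
      exact nonpos_of_mul_nonpos_right (neg_nonneg.1 hw) hk
    have hsq : 0 ≤ (x - y) ⬝ᵥ (x - y) := by
      simpa using dotProduct_star_self_nonneg (x - y)
    rw [sub_eq_zero.1 (dotProduct_self_eq_zero.1 (hww.antisymm hsq))]
  simp only [dotProduct_sub, sub_dotProduct, dotProduct_smul, smul_dotProduct, smul_eq_mul,
    dotProduct_comm y x] at hw hd
  have hdx : 0 ≤ l * (x ⬝ᵥ y) - k * (x ⬝ᵥ x) := by
    refine nonneg_of_mul_nonneg_right ?_ (sub_pos.2 hlt)
    nlinarith [mul_nonneg (hk.trans hlt).le hw]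
  nlinarith [mul_nonneg hk.le hdx]

/-- The second term of `S(k,h)` is nondecreasing in the penalty parameter: for
every `α ∈ ℝᵖ`, the function `k ↦ k²·αᵀ·(XᵀX + k·I)⁻¹·(XᵀX + k·I)⁻¹·α
= k²·‖(XᵀX + k·I)⁻¹·α‖²` is monotone nondecreasing on `(0,∞)`. -/
theorem S_second_term_monotone {n p : ℕ}
    (X : Matrix (Fin n) (Fin p) ℝ) (α : Fin p → ℝ) :
    MonotoneOn (fun k : ℝ =>
        k ^ 2 * (((Xᵀ * X + k • (1 : Matrix (Fin p) (Fin p) ℝ))⁻¹ *ᵥ α) ⬝ᵥ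
            ((Xᵀ * X + k • (1 : Matrix (Fin p) (Fin p) ℝ))⁻¹ *ᵥ α)))
      (Set.Ioi (0 : ℝ)) := by
  intro k hk l hl hkl
  have hA : (Xᵀ * X).PosSemidef := by
    simpa using posSemidef_conjTranspose_mul_self X
  have hsolve : ∀ c : ℝ, 0 < c → (Xᵀ * X) *ᵥ ((Xᵀ * X + c • 1)⁻¹ *ᵥ α) +
      c • ((Xᵀ * X + c • 1)⁻¹ *ᵥ α) = α := by
    intro c hc
    have hdet : IsUnit (Xᵀ * X + c • (1 : Matrix (Fin p) (Fin p) ℝ)).det :=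
      (isUnit_iff_isUnit_det _).1 (PosDef.posSemidef_add hA (PosDef.one.smul hc)).isUnit
    have h := congrArg (· *ᵥ α) (mul_nonsing_inv _ hdet)
    simpa only [← mulVec_mulVec, add_mulVec, smul_mulVec, one_mulVec] using h
  exact hA.sq_mul_dotProduct_le hk hkl ((hsolve k hk).trans (hsolve l hl).symm)
end

section
/- The goodness-of-fit of the ridge estimator is nonincreasing in the penalty parameter: if XᵀX is positive definite and β̂(k) = (XᵀX + k·I)⁻¹·Xᵀy denotes the ridge estimator, then the function k ↦ β̂(k)ᵀ·(XᵀX + 2k·I)·β̂(k) is monotone nonincreasing on [0,∞). -/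
open Matrix

/-- If `(S + j) a = (S + k) b` with `S` positive semidefinite and `0 ≤ j < k`, then
`bᵀ(S + 2k)b ≤ aᵀ(S + 2j)a`. -/
theorem Matrix.PosSemidef.dotProduct_add_two_mul_smul_mulVec_le {ι : Type*} [Fintype ι]
    [DecidableEq ι] {S : Matrix ι ι ℝ} (hS : S.PosSemidef) {j k : ℝ} (hj : 0 ≤ j) (hjk : j < k)
    {a b : ι → ℝ} (hab : (S + j • (1 : Matrix ι ι ℝ)) *ᵥ a = (S + k • (1 : Matrix ι ι ℝ)) *ᵥ b) :
    b ⬝ᵥ ((S + (2 * k) • (1 : Matrix ι ι ℝ)) *ᵥ b) ≤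
      a ⬝ᵥ ((S + (2 * j) • (1 : Matrix ι ι ℝ)) *ᵥ a) := by
  have hsymm : b ⬝ᵥ (S *ᵥ a) = a ⬝ᵥ (S *ᵥ b) := by
    have hT : Sᵀ = S := by simpa [conjTranspose_eq_transpose_of_trivial] using hS.isHermitian.eq
    rw [dotProduct_comm, dotProduct_mulVec, ← mulVec_transpose, hT]
  have hSd : 0 ≤ (a - b) ⬝ᵥ (S *ᵥ (a - b)) := by
    simpa using hS.dotProduct_mulVec_nonneg (a - b)
  have hdd : 0 ≤ (a - b) ⬝ᵥ (a - b) := by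
    simpa using dotProduct_star_self_nonneg (a - b)
  have ha := congrArg (a ⬝ᵥ ·) hab
  have hb := congrArg (b ⬝ᵥ ·) hab
  simp only [add_mulVec, smul_mulVec, one_mulVec, dotProduct_add, dotProduct_smul, smul_eq_mul,
    mulVec_sub, dotProduct_sub, sub_dotProduct, hsymm, dotProduct_comm b a] at *
  have hda : 0 ≤ a ⬝ᵥ a - a ⬝ᵥ b := by
    refine nonneg_of_mul_nonneg_right (a := k - j) ?_ (sub_pos.2 hjk)
    nlinarith
  nlinarith

/-- The goodness-of-fit of the ridge estimator is nonincreasing in the penalty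
parameter: if `XᵀX` is positive definite and `β̂(k) = (XᵀX + k·I)⁻¹·Xᵀy` denotes
the ridge estimator, then `k ↦ β̂(k)ᵀ·(XᵀX + 2k·I)·β̂(k)` is monotone
nonincreasing on `[0,∞)`. -/
theorem ridge_goodness_of_fit_antitone {n p : ℕ}
    (X : Matrix (Fin n) (Fin p) ℝ) (y : Fin n → ℝ)
    (hX : (Xᵀ * X).PosDef) :
    AntitoneOn (fun k : ℝ =>
        ((Xᵀ * X + k • (1 : Matrix (Fin p) (Fin p) ℝ))⁻¹ *ᵥ (Xᵀ *ᵥ y)) ⬝ᵥ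
          ((Xᵀ * X + (2 * k) • (1 : Matrix (Fin p) (Fin p) ℝ)) *ᵥ
            ((Xᵀ * X + k • (1 : Matrix (Fin p) (Fin p) ℝ))⁻¹ *ᵥ (Xᵀ *ᵥ y))))
      (Set.Ici (0 : ℝ)) := by
  intro j hj k hk hjk
  rcases hjk.eq_or_lt with rfl | hjk
  · exact le_rfl
  have hmul (t : ℝ) (ht : 0 ≤ t) :
      (Xᵀ * X + t • (1 : Matrix (Fin p) (Fin p) ℝ)) *ᵥ
        ((Xᵀ * X + t • (1 : Matrix (Fin p) (Fin p) ℝ))⁻¹ *ᵥ (Xᵀ *ᵥ y)) = Xᵀ *ᵥ y := by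
    have hdet := (hX.add_posSemidef (PosSemidef.one.smul ht)).det_pos.ne'.isUnit
    rw [mulVec_mulVec, mul_nonsing_inv _ hdet, one_mulVec]
  exact hX.posSemidef.dotProduct_add_two_mul_smul_mulVec_le hj hjk
    ((hmul j hj).trans (hmul k hk).symm)
end

section
/- The norm of the ridge estimator is nonincreasing in the penalty parameter: if XᵀX is positive definite, then the function k ↦ ‖(XᵀX + k·I)⁻¹·Xᵀy‖ is monotone nonincreasing on [0,∞), and it tends to 0 as k → ∞. -/
open Matrix Filter

/-- The Euclidean norm of a vector in `ℝᵖ`. -/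
noncomputable def euclNorm {p : ℕ} (v : Fin p → ℝ) : ℝ :=
  Real.sqrt (∑ i, v i ^ 2)

/-- The Euclidean norm in terms of the dot product. -/
lemma euclNorm_eq_sqrt_dotProduct {p : ℕ} (v : Fin p → ℝ) :
    euclNorm v = Real.sqrt (v ⬝ᵥ v) := by
  simp only [euclNorm, dotProduct, sq]

lemma Matrix.PosDef.add_smul_one_mulVec_inv {p : ℕ} {A : Matrix (Fin p) (Fin p) ℝ}
    (hA : A.PosDef) {k : ℝ} (hk : 0 ≤ k) (w : Fin p → ℝ) :
    A *ᵥ ((A + k • (1 : Matrix (Fin p) (Fin p) ℝ))⁻¹ *ᵥ w) +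
      k • ((A + k • (1 : Matrix (Fin p) (Fin p) ℝ))⁻¹ *ᵥ w) = w := by
  have hpd : (A + k • (1 : Matrix (Fin p) (Fin p) ℝ)).PosDef :=
    hA.add_posSemidef (Matrix.PosSemidef.one.smul hk)
  have hdet := (Matrix.isUnit_iff_isUnit_det _).mp hpd.isUnit
  have h : (A + k • (1 : Matrix (Fin p) (Fin p) ℝ)) *ᵥ
      ((A + k • (1 : Matrix (Fin p) (Fin p) ℝ))⁻¹ *ᵥ w) = w := by
    rw [mulVec_mulVec, mul_nonsing_inv _ hdet, one_mulVec]
  rwa [add_mulVec, smul_mulVec, one_mulVec] at h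

/-- Solutions of `A u + a u = w` have norm nonincreasing in the shift `a ≥ 0`. -/
lemma Matrix.PosSemidef.euclNorm_le_of_shift_le {p : ℕ} {A : Matrix (Fin p) (Fin p) ℝ}
    (hA : A.PosSemidef) {a b : ℝ} (ha : 0 ≤ a) (hab : a < b) {u v w : Fin p → ℝ}
    (hu : A *ᵥ u + a • u = w) (hv : A *ᵥ v + b • v = w) :
    euclNorm v ≤ euclNorm u := by
  obtain ⟨d, rfl⟩ : ∃ d, u = v + d := ⟨u - v, by simp⟩
  have hd : A *ᵥ d + a • d = (b - a) • v := by
    have h := hu.trans hv.symm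
    rw [mulVec_add] at h
    ext i
    have hi := congrFun h i
    simp only [Pi.add_apply, Pi.smul_apply, smul_eq_mul] at hi ⊢
    linarith
  have hAd : 0 ≤ d ⬝ᵥ (A *ᵥ d) := by simpa using hA.dotProduct_mulVec_nonneg d
  have hdd : 0 ≤ d ⬝ᵥ d := by simpa using dotProduct_star_self_nonneg d
  have heq : d ⬝ᵥ (A *ᵥ d) + a * (d ⬝ᵥ d) = (b - a) * (d ⬝ᵥ v) := by
    simpa only [dotProduct_add, dotProduct_smul, smul_eq_mul] using congrArg (d ⬝ᵥ ·) hd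
  have hdv : 0 ≤ d ⬝ᵥ v :=
    nonneg_of_mul_nonneg_right (heq ▸ add_nonneg hAd (mul_nonneg ha hdd)) (sub_pos.mpr hab)
  rw [euclNorm_eq_sqrt_dotProduct, euclNorm_eq_sqrt_dotProduct]
  apply Real.sqrt_le_sqrt
  rw [add_dotProduct, dotProduct_add, dotProduct_add, dotProduct_comm v d]
  linarith

/-- Solutions of `A v + k v = w` have norm at most `‖w‖ / k`. -/
lemma Matrix.PosSemidef.euclNorm_le_div_shift {p : ℕ} {A : Matrix (Fin p) (Fin p) ℝ}
    (hA : A.PosSemidef) {k : ℝ} (hk : 0 < k) {v w : Fin p → ℝ}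
    (hv : A *ᵥ v + k • v = w) :
    euclNorm v ≤ euclNorm w / k := by
  have hAv : 0 ≤ v ⬝ᵥ (A *ᵥ v) := by simpa using hA.dotProduct_mulVec_nonneg v
  have hAA : 0 ≤ (A *ᵥ v) ⬝ᵥ (A *ᵥ v) := by
    simpa using dotProduct_star_self_nonneg (A *ᵥ v)
  rw [euclNorm_eq_sqrt_dotProduct, euclNorm_eq_sqrt_dotProduct, le_div_iff₀ hk]
  apply Real.le_sqrt_of_sq_le
  rw [mul_pow, Real.sq_sqrt (by simpa using dotProduct_star_self_nonneg v), ← hv]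
  simp only [add_dotProduct, dotProduct_add, dotProduct_smul, smul_dotProduct, smul_eq_mul]
  rw [dotProduct_comm (A *ᵥ v) v]
  nlinarith [mul_nonneg hk.le hAv]

/-- The norm of the ridge estimator is nonincreasing in the penalty parameter:
if `XᵀX` is positive definite, then `k ↦ ‖(XᵀX + k·I)⁻¹·Xᵀy‖` is monotone
nonincreasing on `[0,∞)` and tends to `0` as `k → ∞`. -/
theorem ridge_norm_antitone_tendsto_zero {n p : ℕ}
    (X : Matrix (Fin n) (Fin p) ℝ) (y : Fin n → ℝ)
    (hX : (Xᵀ * X).PosDef) :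
    AntitoneOn (fun k : ℝ =>
        euclNorm ((Xᵀ * X + k • (1 : Matrix (Fin p) (Fin p) ℝ))⁻¹ *ᵥ (Xᵀ *ᵥ y)))
      (Set.Ici (0 : ℝ)) ∧
    Tendsto (fun k : ℝ =>
        euclNorm ((Xᵀ * X + k • (1 : Matrix (Fin p) (Fin p) ℝ))⁻¹ *ᵥ (Xᵀ *ᵥ y)))
      atTop (nhds 0) := by
  constructor
  · intro a ha b hb hab
    rcases hab.eq_or_lt with rfl | hlt
    · exact le_rfl
    · exact hX.posSemidef.euclNorm_le_of_shift_le ha hlt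
        (hX.add_smul_one_mulVec_inv ha _) (hX.add_smul_one_mulVec_inv hb _)
  · refine squeeze_zero' (Eventually.of_forall fun k => Real.sqrt_nonneg _) ?_
      (tendsto_const_nhds.div_atTop tendsto_id : Tendsto
        (fun k : ℝ => euclNorm (Xᵀ *ᵥ y) / id k) atTop (nhds 0))
    filter_upwards [eventually_gt_atTop 0] with k hk
    exact hX.posSemidef.euclNorm_le_div_shift hk (hX.add_smul_one_mulVec_inv hk.le _)
end

section
/- The third component of the goodness-of-fit is nondecreasing in the penalty parameter: for every v ∈ ℝᵖ, the function k ↦ k²·vᵀ·(XᵀX + k·I)⁻¹·XᵀX·(XᵀX + k·I)⁻¹·v is monotone nondecreasing on (0,∞). -/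
open Matrix

section Ridge

variable {m ι : Type*} [Fintype m] [Fintype ι] [DecidableEq ι]

/-- The ridge matrix `XᵀX + k·I` is invertible for `k > 0`. -/
theorem isUnit_ridge (X : Matrix m ι ℝ) {k : ℝ} (hk : 0 < k) :
    IsUnit (Xᵀ * X + k • (1 : Matrix ι ι ℝ)) := by
  have hX : (Xᵀ * X).PosSemidef := by
    simpa only [conjTranspose_eq_transpose_of_trivial] using
      posSemidef_conjTranspose_mul_self X
  exact (PosDef.posSemidef_add hX (PosDef.one.smul hk)).isUnit

/-- If `(XᵀX + k·I) u = v`, the quadratic form of `(XᵀX + k·I)⁻¹ XᵀX (XᵀX + k·I)⁻¹` at `v`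
is `‖X u‖²`. -/
theorem dotProduct_ridge_inv_mulVec (X : Matrix m ι ℝ) {k : ℝ} (hk : 0 < k) {u v : ι → ℝ}
    (h : (Xᵀ * X + k • (1 : Matrix ι ι ℝ)) *ᵥ u = v) :
    v ⬝ᵥ (((Xᵀ * X + k • (1 : Matrix ι ι ℝ))⁻¹ * (Xᵀ * X)
      * (Xᵀ * X + k • (1 : Matrix ι ι ℝ))⁻¹) *ᵥ v) = (X *ᵥ u) ⬝ᵥ (X *ᵥ u) := by
  have hdet := (isUnit_iff_isUnit_det _).1 (isUnit_ridge X hk)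
  have hsymm : (Xᵀ * X + k • (1 : Matrix ι ι ℝ))ᵀ = Xᵀ * X + k • (1 : Matrix ι ι ℝ) := by
    simp
  have hu : (Xᵀ * X + k • (1 : Matrix ι ι ℝ))⁻¹ *ᵥ v = u := by
    rw [← h, mulVec_mulVec, nonsing_inv_mul _ hdet, one_mulVec]
  have hu' : v ᵥ* (Xᵀ * X + k • (1 : Matrix ι ι ℝ))⁻¹ = u := by
    rw [← mulVec_transpose, transpose_nonsing_inv, hsymm, hu]
  rw [← mulVec_mulVec, hu, ← mulVec_mulVec, dotProduct_mulVec, hu', ← mulVec_mulVec,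
    dotProduct_mulVec, vecMul_transpose]

end Ridge

/-- The third component of the goodness-of-fit is nondecreasing in the penalty
parameter: for every `v ∈ ℝᵖ`, the function
`k ↦ k²·vᵀ·(XᵀX + k·I)⁻¹·XᵀX·(XᵀX + k·I)⁻¹·v` is monotone nondecreasing on
`(0,∞)`. -/
theorem gof_third_term_monotone {n p : ℕ}
    (X : Matrix (Fin n) (Fin p) ℝ) (v : Fin p → ℝ) :
    MonotoneOn (fun k : ℝ =>
        k ^ 2 * (v ⬝ᵥ (((Xᵀ * X + k • (1 : Matrix (Fin p) (Fin p) ℝ))⁻¹ * (Xᵀ * X)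
            * (Xᵀ * X + k • (1 : Matrix (Fin p) (Fin p) ℝ))⁻¹) *ᵥ v)))
      (Set.Ioi (0 : ℝ)) := by
  intro a (ha : 0 < a) b (hb : 0 < b) hab
  obtain ⟨w, rfl⟩ : ∃ w, (Xᵀ * X + a • (1 : Matrix (Fin p) (Fin p) ℝ)) *ᵥ
      ((Xᵀ * X + b • (1 : Matrix (Fin p) (Fin p) ℝ)) *ᵥ w) = v := by
    obtain ⟨u, hu⟩ := mulVec_surjective_iff_isUnit.2 (isUnit_ridge X ha) v
    obtain ⟨w, rfl⟩ := mulVec_surjective_iff_isUnit.2 (isUnit_ridge X hb) u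
    exact ⟨w, hu⟩
  have hcomm : (Xᵀ * X + b • (1 : Matrix (Fin p) (Fin p) ℝ)) *ᵥ
      ((Xᵀ * X + a • (1 : Matrix (Fin p) (Fin p) ℝ)) *ᵥ w) =
      (Xᵀ * X + a • (1 : Matrix (Fin p) (Fin p) ℝ)) *ᵥ
      ((Xᵀ * X + b • (1 : Matrix (Fin p) (Fin p) ℝ)) *ᵥ w) := by
    have h : Commute (Xᵀ * X + b • (1 : Matrix (Fin p) (Fin p) ℝ)) (Xᵀ * X + a • 1) :=
      ((Commute.refl _).add_left ((Commute.one_left _).smul_left b)).add_right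
        ((Commute.one_right _).smul_right a)
    rw [mulVec_mulVec, mulVec_mulVec, h.eq]
  beta_reduce
  rw [dotProduct_ridge_inv_mulVec X ha rfl, dotProduct_ridge_inv_mulVec X hb hcomm]
  have hX (k : ℝ) : X *ᵥ ((Xᵀ * X + k • (1 : Matrix (Fin p) (Fin p) ℝ)) *ᵥ w) =
      X *ᵥ (Xᵀ *ᵥ (X *ᵥ w)) + k • (X *ᵥ w) := by
    simp [add_mulVec, smul_mulVec, mulVec_add, mulVec_smul]
  rw [hX, hX]
  have hcross : 0 ≤ (X *ᵥ w) ⬝ᵥ (X *ᵥ (Xᵀ *ᵥ (X *ᵥ w))) := by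
    rw [dotProduct_mulVec, ← mulVec_transpose]
    exact Finset.sum_nonneg fun i _ => mul_self_nonneg _
  generalize X *ᵥ (Xᵀ *ᵥ (X *ᵥ w)) = z at hcross ⊢
  generalize X *ᵥ w = y at hcross ⊢
  have hz : 0 ≤ z ⬝ᵥ z := Finset.sum_nonneg fun i _ => mul_self_nonneg _
  simp only [add_dotProduct, dotProduct_add, smul_dotProduct, dotProduct_smul, smul_eq_mul,
    dotProduct_comm z y]
  have h₁ : 0 ≤ (b ^ 2 - a ^ 2) * (z ⬝ᵥ z) :=
    mul_nonneg (sub_nonneg.2 (pow_le_pow_left₀ ha.le hab 2)) hz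
  have h₂ : 0 ≤ a * b * (b - a) * (y ⬝ᵥ z) :=
    mul_nonneg (mul_nonneg (mul_pos ha hb).le (sub_nonneg.2 hab)) hcross
  linarith
end
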